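/- arXiv:2409.13874 — 3 statements merged into one kernel-verified Lean document; each statement's English description precedes it below -/
import Mathlib

section
/- For all integers s, t ≥ 0 and every integer n ≥ 1, the convolution of divisor power sums satisfies: Σ_{a=1}^{n-1} σ_s(a)·σ_t(n−a) = σ_{(s,t)}(n) + σ_{(t,s)}(n) + (s!·t!/(s+t+1)!)·σ_{s+t+1}(n) + Σ_{j=0}^{s} C(s,j)·(−1)^t·(B_{s+t+1−j}/(s+t+1−j))·σ_j(n) + Σ_{j=0}^{t} C(t,j)·(−1)^s·(B_{s+t+1−j}/(s+t+1−j))·σ_j(n), as an identity of rational numbers. -/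
open Finset

/-- Divisor power sum `σ_k(n) = ∑_{d ∣ n} d^k`. -/
def sigmaPow (k n : ℕ) : ℕ := ∑ d ∈ n.divisors, d ^ k

/-- Depth-two multiple divisor sum `σ_{(s,t)}(n)`: the sum of `m1^s · m2^t` over all
quadruples of positive integers `((m1, m2), (n1, n2))` with `m1·n1 + m2·n2 = n` and `n1 < n2`. -/
def sigmaPow2 (s t n : ℕ) : ℕ :=
  ∑ p ∈ ((Finset.Icc 1 n ×ˢ Finset.Icc 1 n) ×ˢ (Finset.Icc 1 n ×ˢ Finset.Icc 1 n)).filter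
      (fun p => p.1.1 * p.2.1 + p.1.2 * p.2.2 = n ∧ p.2.1 < p.2.2),
    p.1.1 ^ s * p.1.2 ^ t

/-- The positive quadruples `((m₁, m₂), (n₁, n₂))` with `m₁ * n₁ + m₂ * n₂ = n`. -/
def positiveQuadruples (n : ℕ) : Finset ((ℕ × ℕ) × (ℕ × ℕ)) :=
  ((Finset.Icc 1 n ×ˢ Finset.Icc 1 n) ×ˢ (Finset.Icc 1 n ×ˢ Finset.Icc 1 n)).filter
    (fun p => p.1.1 * p.2.1 + p.1.2 * p.2.2 = n)

theorem mem_positiveQuadruples {n : ℕ} {p : (ℕ × ℕ) × (ℕ × ℕ)} :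
    p ∈ positiveQuadruples n ↔
      (0 < p.1.1 ∧ 0 < p.1.2 ∧ 0 < p.2.1 ∧ 0 < p.2.2) ∧ p.1.1 * p.2.1 + p.1.2 * p.2.2 = n := by
  simp only [positiveQuadruples, mem_filter, mem_product, mem_Icc]
  constructor
  · rintro ⟨h, e⟩
    exact ⟨by omega, e⟩
  · rintro ⟨⟨h1, h2, h3, h4⟩, e⟩
    have a1 := Nat.le_mul_of_pos_right p.1.1 h3
    have a2 := Nat.le_mul_of_pos_left p.2.1 h1
    have a3 := Nat.le_mul_of_pos_right p.1.2 h4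
    have a4 := Nat.le_mul_of_pos_left p.2.2 h2
    exact ⟨by omega, e⟩

theorem sum_sigmaPow_mul_eq_sum_positiveQuadruples (s t n : ℕ) :
    ∑ a ∈ Finset.Ico 1 n, sigmaPow s a * sigmaPow t (n - a)
      = ∑ p ∈ positiveQuadruples n, p.1.1 ^ s * p.1.2 ^ t := by
  simp only [sigmaPow, sum_mul_sum, ← sum_product']
  rw [sum_sigma']
  refine sum_nbij' (fun x => (x.2, (x.1 / x.2.1, (n - x.1) / x.2.2)))
    (fun p => ⟨p.1.1 * p.2.1, p.1⟩) ?_ ?_ ?_ ?_ ?_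
  · rintro ⟨a, d, e⟩ h
    simp only [mem_sigma, mem_Ico, mem_product, Nat.mem_divisors] at h
    obtain ⟨⟨h1, h2⟩, ⟨hd, -⟩, he, -⟩ := h
    rw [mem_positiveQuadruples]
    have hpos : 0 < n - a := by omega
    refine ⟨⟨Nat.pos_of_dvd_of_pos hd h1, Nat.pos_of_dvd_of_pos he hpos,
      Nat.div_pos (Nat.le_of_dvd h1 hd) (Nat.pos_of_dvd_of_pos hd h1),
      Nat.div_pos (Nat.le_of_dvd hpos he) (Nat.pos_of_dvd_of_pos he hpos)⟩, ?_⟩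
    simp only [Nat.mul_div_cancel' hd, Nat.mul_div_cancel' he]
    omega
  · rintro ⟨⟨a, b⟩, c, d⟩ h
    obtain ⟨⟨h1, h2, h3, h4⟩, e⟩ := mem_positiveQuadruples.1 h
    dsimp only at h1 h2 h3 h4 e
    have hac := Nat.mul_pos h1 h3
    have hbd := Nat.mul_pos h2 h4
    have hn : n - a * c = b * d := by omega
    simp only [mem_sigma, mem_Ico, mem_product, Nat.mem_divisors, hn]
    exact ⟨⟨hac, by omega⟩, ⟨dvd_mul_right _ _, hac.ne'⟩, dvd_mul_right _ _, hbd.ne'⟩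
  · rintro ⟨a, d, e⟩ h
    simp only [mem_sigma, mem_Ico, mem_product, Nat.mem_divisors] at h
    simp only [Nat.mul_div_cancel' h.2.1.1]
  · rintro ⟨⟨a, b⟩, c, d⟩ h
    obtain ⟨⟨h1, h2, h3, h4⟩, e⟩ := mem_positiveQuadruples.1 h
    dsimp only at h1 h2 h3 h4 e
    have hn : n - a * c = b * d := by omega
    simp only [hn, Nat.mul_div_cancel_left _ h1, Nat.mul_div_cancel_left _ h2]
  · rintro ⟨a, d, e⟩ h
    rfl

theorem sigmaPow2_eq_sum_filter_lt (s t n : ℕ) :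
    sigmaPow2 s t n
      = ∑ p ∈ positiveQuadruples n with p.2.1 < p.2.2, p.1.1 ^ s * p.1.2 ^ t := by
  rw [sigmaPow2, positiveQuadruples, filter_filter]

theorem sigmaPow2_eq_sum_filter_gt (s t n : ℕ) :
    sigmaPow2 t s n
      = ∑ p ∈ positiveQuadruples n with p.2.2 < p.2.1, p.1.1 ^ s * p.1.2 ^ t := by
  rw [sigmaPow2_eq_sum_filter_lt]
  refine sum_nbij' (fun p => (p.1.swap, p.2.swap)) (fun p => (p.1.swap, p.2.swap)) ?_ ?_ ?_ ?_ ?_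
  · rintro ⟨⟨a, b⟩, c, d⟩ h
    simp only [mem_filter, mem_positiveQuadruples, Prod.swap] at h ⊢
    omega
  · rintro ⟨⟨a, b⟩, c, d⟩ h
    simp only [mem_filter, mem_positiveQuadruples, Prod.swap] at h ⊢
    omega
  · intro p h
    simp
  · intro p h
    simp
  · intro p h
    exact mul_comm _ _

theorem sum_filter_eq_positiveQuadruples (s t n : ℕ) (hn : 1 ≤ n) :
    ∑ p ∈ positiveQuadruples n with p.2.1 = p.2.2, p.1.1 ^ s * p.1.2 ^ t
      = ∑ d ∈ n.divisors, ∑ a ∈ Finset.Ico 1 d, a ^ s * (d - a) ^ t := by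
  rw [sum_sigma']
  symm
  refine sum_nbij' (fun x => ((x.2, x.1 - x.2), (n / x.1, n / x.1)))
    (fun p => ⟨p.1.1 + p.1.2, p.1.1⟩) ?_ ?_ ?_ ?_ ?_
  · rintro ⟨d, a⟩ h
    simp only [mem_sigma, mem_Ico, Nat.mem_divisors] at h
    obtain ⟨⟨hd, -⟩, h1, h2⟩ := h
    have hpos := Nat.div_pos (Nat.le_of_dvd hn hd) (by omega : 0 < d)
    simp only [mem_filter, mem_positiveQuadruples, and_true]
    refine ⟨⟨h1, by omega, hpos, hpos⟩, ?_⟩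
    rw [← add_mul, Nat.add_sub_cancel' h2.le, Nat.mul_div_cancel' hd]
  · rintro ⟨⟨a, b⟩, c, d⟩ h
    simp only [mem_filter, mem_positiveQuadruples] at h
    obtain ⟨⟨⟨h1, h2, h3, h4⟩, e⟩, rfl⟩ := h
    simp only [mem_sigma, mem_Ico, Nat.mem_divisors]
    exact ⟨⟨⟨c, by rw [← e, add_mul]⟩, by omega⟩, h1, by omega⟩
  · rintro ⟨d, a⟩ h
    simp only [mem_sigma, mem_Ico, Nat.mem_divisors] at h
    simp only [Nat.add_sub_cancel' h.2.2.le]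
  · rintro ⟨⟨a, b⟩, c, d⟩ h
    simp only [mem_filter, mem_positiveQuadruples] at h
    obtain ⟨⟨⟨h1, h2, h3, h4⟩, e⟩, rfl⟩ := h
    have hc : n / (a + b) = c := by
      rw [← e, ← add_mul]
      exact Nat.mul_div_cancel_left _ (by omega)
    simp only [hc, Nat.add_sub_cancel_left]
  · rintro ⟨d, a⟩ h
    rfl

theorem sum_sigmaPow_mul_eq_sigmaPow2_add (s t n : ℕ) (hn : 1 ≤ n) :
    ∑ a ∈ Finset.Ico 1 n, sigmaPow s a * sigmaPow t (n - a)
      = sigmaPow2 s t n + sigmaPow2 t s n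
        + ∑ d ∈ n.divisors, ∑ a ∈ Finset.Ico 1 d, a ^ s * (d - a) ^ t := by
  rw [sum_sigmaPow_mul_eq_sum_positiveQuadruples, sigmaPow2_eq_sum_filter_lt s t,
    sigmaPow2_eq_sum_filter_gt s t, ← sum_filter_eq_positiveQuadruples s t n hn]
  simp only [sum_filter, ← sum_add_distrib]
  refine sum_congr rfl fun p _ => ?_
  rcases lt_trichotomy p.2.1 p.2.2 with h | h | h
  · simp [h, h.ne, h.not_gt]
  · simp [h]
  · simp [h, h.ne', h.not_gt]

/-- One of the two Bernoulli sums in the closed form of `∑ a ^ s * (x - a) ^ t`. -/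
def bernoulliConvolution (s t : ℕ) (x : ℚ) : ℚ :=
  ∑ j ∈ Finset.range (s + 1),
    (s.choose j : ℚ) * (-1 : ℚ) ^ t
      * (bernoulli (s + t + 1 - j) / ((s + t + 1 - j : ℕ) : ℚ)) * x ^ j

theorem bernoulliConvolution_succ_add (s t : ℕ) (x : ℚ) :
    bernoulliConvolution (s + 1) t x + bernoulliConvolution s (t + 1) x
      = x * bernoulliConvolution s t x := by
  have h : bernoulliConvolution s (t + 1) x = ∑ j ∈ Finset.range (s + 1 + 1),
      (s.choose j : ℚ) * (-1 : ℚ) ^ (t + 1)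
        * (bernoulli (s + (t + 1) + 1 - j) / ((s + (t + 1) + 1 - j : ℕ) : ℚ)) * x ^ j := by
    rw [sum_range_succ _ (s + 1), bernoulliConvolution]
    simp
  rw [h, bernoulliConvolution, bernoulliConvolution, ← sum_add_distrib, sum_range_succ', mul_sum]
  have e0 : s + 1 + t + 1 = s + (t + 1) + 1 := by omega
  simp only [e0]
  rw [add_eq_left.2 (by simp [pow_succ])]
  refine sum_congr rfl fun j _ => ?_
  have e1 : s + (t + 1) + 1 - (j + 1) = s + t + 1 - j := by omega
  rw [e1, Nat.choose_succ_succ]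
  push_cast
  ring

theorem sum_Ico_one_pow_eq_bernoulliConvolution (s d : ℕ) (hd : 1 ≤ d) :
    ∑ a ∈ Finset.Ico 1 d, (a : ℚ) ^ s
      = (d : ℚ) ^ (s + 1) / (s + 1) + bernoulliConvolution s 0 d + bernoulliConvolution 0 s d := by
  have hF := sum_range_pow d s
  rw [range_eq_Ico, sum_eq_sum_Ico_succ_bot hd, zero_add] at hF
  rw [eq_sub_of_add_eq' hF]
  have h : ∑ i ∈ Finset.range (s + 1),
        bernoulli i * ((s + 1).choose i : ℚ) * (d : ℚ) ^ (s + 1 - i) / (s + 1)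
      = (d : ℚ) ^ (s + 1) / (s + 1)
        + (bernoulliConvolution s 0 d - bernoulli (s + 1) / (s + 1)) := by
    rw [sum_range_succ', bernoulliConvolution, sum_range_succ', ← sum_range_reflect, add_comm]
    have e : ∀ j ∈ Finset.range s,
        bernoulli (s - 1 - j + 1) * ((s + 1).choose (s - 1 - j + 1) : ℚ)
            * (d : ℚ) ^ (s + 1 - (s - 1 - j + 1)) / (s + 1)
          = (s.choose (j + 1) : ℚ) * (-1 : ℚ) ^ 0
            * (bernoulli (s + 0 + 1 - (j + 1)) / ((s + 0 + 1 - (j + 1) : ℕ) : ℚ))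
            * (d : ℚ) ^ (j + 1) := by
      intro j hj
      rw [mem_range] at hj
      obtain ⟨k, rfl⟩ := Nat.exists_eq_add_of_lt hj
      have e1 : j + k + 1 - 1 - j + 1 = k + 1 := by omega
      have e2 : j + k + 1 + 1 - (k + 1) = j + 1 := by omega
      have e3 : j + k + 1 + 0 + 1 - (j + 1) = k + 1 := by omega
      rw [e1, e2, e3]
      have hc : (j + k + 1 + 1).choose (k + 1) * (k + 1)
          = (j + k + 1 + 1) * (j + k + 1).choose (j + 1) := by
        have := Nat.add_one_mul_choose_eq (j + k + 1) k
        rw [← this, Nat.choose_symm_of_eq_add (by omega : j + k + 1 = k + (j + 1))]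
      have hq := congrArg (Nat.cast (R := ℚ)) hc
      push_cast at hq ⊢
      field_simp
      linear_combination bernoulli (k + 1) * hq
    rw [sum_congr rfl e]
    simp
  rw [h]
  have h0 : bernoulliConvolution 0 s d = (-1) ^ s * (bernoulli (s + 1) / (s + 1)) := by
    simp [bernoulliConvolution]
  rw [h0]
  rcases Nat.eq_zero_or_pos s with rfl | hs
  · norm_num
    ring
  · rcases Nat.even_or_odd s with he | ho
    · simp [bernoulli_eq_zero_of_odd he.add_one (by omega), hs.ne']
    · simp [ho.neg_one_pow, hs.ne']
      ring

theorem sum_Ico_pow_mul_sub_pow (s t d : ℕ) (hd : 1 ≤ d) :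
    ∑ a ∈ Finset.Ico 1 d, (a : ℚ) ^ s * ((d : ℚ) - a) ^ t
      = ((s.factorial * t.factorial : ℚ) / ((s + t + 1).factorial : ℚ)) * (d : ℚ) ^ (s + t + 1)
        + bernoulliConvolution s t d + bernoulliConvolution t s d := by
  induction t generalizing s with
  | zero =>
    simp only [pow_zero, mul_one, sum_Ico_one_pow_eq_bernoulliConvolution s d hd, add_zero,
      Nat.factorial_zero, Nat.factorial_succ]
    have := s.factorial_ne_zero
    push_cast
    field_simp
  | succ t ih =>
    have hrec : ∑ a ∈ Finset.Ico 1 d, (a : ℚ) ^ s * ((d : ℚ) - a) ^ (t + 1)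
        = d * ∑ a ∈ Finset.Ico 1 d, (a : ℚ) ^ s * ((d : ℚ) - a) ^ t
          - ∑ a ∈ Finset.Ico 1 d, (a : ℚ) ^ (s + 1) * ((d : ℚ) - a) ^ t := by
      rw [mul_sum, ← sum_sub_distrib]
      exact sum_congr rfl fun a _ => by ring
    rw [hrec, ih, ih]
    have h1 := bernoulliConvolution_succ_add s t d
    have h2 := bernoulliConvolution_succ_add t s d
    have hβ : (((s + 1).factorial * t.factorial : ℚ) / ((s + 1 + t + 1).factorial : ℚ))
          * (d : ℚ) ^ (s + 1 + t + 1)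
        + ((s.factorial * (t + 1).factorial : ℚ) / ((s + (t + 1) + 1).factorial : ℚ))
          * (d : ℚ) ^ (s + (t + 1) + 1)
        = d * (((s.factorial * t.factorial : ℚ) / ((s + t + 1).factorial : ℚ))
          * (d : ℚ) ^ (s + t + 1)) := by
      have e1 : s + 1 + t + 1 = s + t + 1 + 1 := by omega
      have e2 : s + (t + 1) + 1 = s + t + 1 + 1 := by omega
      have := (s + t + 1).factorial_ne_zero
      rw [e1, e2, Nat.factorial_succ (s + t + 1), Nat.factorial_succ s, Nat.factorial_succ t]
      have h3 : ((s : ℚ) + t + 1 + 1) ≠ 0 := by positivity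
      push_cast
      field_simp
      ring
    linear_combination -hβ - h1 - h2

theorem sum_divisors_bernoulliConvolution (s t n : ℕ) :
    ∑ d ∈ n.divisors, bernoulliConvolution s t d
      = ∑ j ∈ Finset.range (s + 1),
          (s.choose j : ℚ) * (-1 : ℚ) ^ t
            * (bernoulli (s + t + 1 - j) / ((s + t + 1 - j : ℕ) : ℚ)) * (sigmaPow j n : ℚ) := by
  simp only [bernoulliConvolution, sigmaPow]
  rw [sum_comm]
  push_cast
  simp only [mul_sum]

theorem convolution_of_divisor_sums (s t n : ℕ) (hn : 1 ≤ n) :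
    ∑ a ∈ Finset.Ico 1 n, (sigmaPow s a : ℚ) * (sigmaPow t (n - a) : ℚ)
      = (sigmaPow2 s t n : ℚ) + (sigmaPow2 t s n : ℚ)
        + ((s.factorial * t.factorial : ℚ) / ((s + t + 1).factorial : ℚ))
            * (sigmaPow (s + t + 1) n : ℚ)
        + ∑ j ∈ Finset.range (s + 1),
            (s.choose j : ℚ) * (-1 : ℚ) ^ t
              * (bernoulli (s + t + 1 - j) / ((s + t + 1 - j : ℕ) : ℚ)) * (sigmaPow j n : ℚ)
        + ∑ j ∈ Finset.range (t + 1),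
            (t.choose j : ℚ) * (-1 : ℚ) ^ s
              * (bernoulli (s + t + 1 - j) / ((s + t + 1 - j : ℕ) : ℚ)) * (sigmaPow j n : ℚ) := by
  have h := congrArg (Nat.cast (R := ℚ)) (sum_sigmaPow_mul_eq_sigmaPow2_add s t n hn)
  push_cast at h
  have hdiag : ∑ d ∈ n.divisors, ∑ a ∈ Finset.Ico 1 d, (a : ℚ) ^ s * ((d - a : ℕ) : ℚ) ^ t
      = ∑ d ∈ n.divisors,
        (((s.factorial * t.factorial : ℚ) / ((s + t + 1).factorial : ℚ)) * (d : ℚ) ^ (s + t + 1)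
          + bernoulliConvolution s t d + bernoulliConvolution t s d) := by
    refine sum_congr rfl fun d hd => ?_
    rw [← sum_Ico_pow_mul_sub_pow s t d (Nat.pos_of_mem_divisors hd)]
    refine sum_congr rfl fun a ha => ?_
    rw [Nat.cast_sub (mem_Ico.1 ha).2.le]
  rw [h, hdiag, sum_add_distrib, sum_add_distrib, sum_divisors_bernoulliConvolution,
    sum_divisors_bernoulliConvolution, ← mul_sum, add_comm t s]
  simp only [sigmaPow]
  push_cast
  ring
end

section
/- For every integer n ≥ 1, Ramanujan's tau function satisfies τ(n) = (200/3)·Σ_{a=1}^{n-1} σ_3(a)·σ_7(n−a) − 147·Σ_{a=1}^{n-1} σ_5(a)·σ_5(n−a) + (5/18)·σ_7(n) + (7/12)·σ_5(n) + (5/36)·σ_3(n), as an identity of rational numbers. -/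
open Finset

/-- Ramanujan's tau function: the coefficient of `q^n` in `q · ∏_{k=1}^{n} (1 - q^k)^24`. -/
noncomputable def ramanujanTau (n : ℕ) : ℤ :=
  ((Polynomial.X : Polynomial ℤ) * ∏ k ∈ Finset.Icc 1 n, (1 - Polynomial.X ^ k) ^ 24).coeff n

open Filter Topology ModularForm EisensteinSeries UpperHalfPlane MatrixGroups

/-- The coefficient defining `ramanujanTau n` is unchanged by further factors of the product. -/
lemma coeff_X_mul_prod_one_sub_X_pow {n N : ℕ} (h : n ≤ N) :
    ((Polynomial.X : Polynomial ℤ) * ∏ k ∈ Finset.Icc 1 N, (1 - Polynomial.X ^ k) ^ 24).coeff n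
      = ramanujanTau n := by
  induction N, h using Nat.le_induction with
  | base => rfl
  | succ N h ih =>
    obtain ⟨r, hr⟩ : (Polynomial.X : Polynomial ℤ) ^ (N + 1) ∣
        (1 - Polynomial.X ^ (N + 1)) ^ 24 - 1 := by
      simpa using sub_dvd_pow_sub_pow (1 - (Polynomial.X : Polynomial ℤ) ^ (N + 1)) 1 24
    rw [Finset.prod_Icc_succ_top (by lia), eq_add_of_sub_eq hr, mul_add, mul_one, mul_add,
      Polynomial.coeff_add, ih, ← mul_assoc, mul_left_comm, mul_assoc, Polynomial.coeff_X_pow_mul',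
      if_neg (by lia), zero_add]

lemma TendstoLocallyUniformlyOn.iteratedDeriv {ι : Type*} {φ : Filter ι} {F : ι → ℂ → ℂ}
    {f : ℂ → ℂ} {U : Set ℂ} (hf : TendstoLocallyUniformlyOn F f φ U)
    (hF : ∀ n, DifferentiableOn ℂ (F n) U) (hU : IsOpen U) (m : ℕ) :
    TendstoLocallyUniformlyOn (fun n ↦ iteratedDeriv m (F n)) (iteratedDeriv m f) φ U := by
  induction m with
  | zero => simpa using hf
  | succ m ih =>
    simp_rw [iteratedDeriv_succ]
    refine ih.deriv (.of_forall fun n ↦ ?_) hU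
    rw [iteratedDeriv_eq_iterate]
    exact ((hF n).analyticOnNhd hU).iterated_deriv m |>.differentiableOn

lemma Polynomial.iteratedDeriv_eval_zero (p : Polynomial ℂ) (m : ℕ) :
    iteratedDeriv m (fun z ↦ p.eval z) 0 = m.factorial * p.coeff m := by
  have h (m : ℕ) : deriv^[m] (fun z ↦ p.eval z) = fun z ↦ (Polynomial.derivative^[m] p).eval z := by
    induction m with
    | zero => rfl
    | succ m ih => ext z; simp only [Function.iterate_succ_apply', ih, Polynomial.deriv]
  rw [iteratedDeriv_eq_iterate, h]
  beta_reduce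
  rw [← Polynomial.coeff_zero_eq_eval_zero, Polynomial.coeff_iterate_derivative]
  simp [Nat.descFactorial_self]

lemma tendstoLocallyUniformlyOn_of_eq_limit {α β ι : Type*} [TopologicalSpace α] [UniformSpace β]
    (f : α → β) (p : Filter ι) (s : Set α) : TendstoLocallyUniformlyOn (fun _ ↦ f) f p s :=
  fun _ hu _ _ ↦ ⟨Set.univ, univ_mem, .of_forall fun _ _ _ ↦ refl_mem_uniformity hu⟩

lemma tendstoLocallyUniformlyOn_mul_prod_one_sub_pow :
    TendstoLocallyUniformlyOn (fun N q ↦ q * ∏ k ∈ Finset.Icc 1 N, (1 - q ^ k) ^ 24)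
      (fun q : ℂ ↦ q * ∏' i : ℕ, (1 - q ^ (i + 1)) ^ 24) atTop (Metric.ball 0 1) := by
  have h := multipliableLocallyUniformlyOn_one_sub_pow.hasProdLocallyUniformlyOn
    |>.tendstoLocallyUniformlyOn_finsetRange
  have hc := differentiableOn_tprod_one_sub_pow.continuousOn
  have hpow (m : ℕ) : TendstoLocallyUniformlyOn
      (fun N q ↦ (∏ k ∈ Finset.range N, (1 - q ^ (k + 1))) ^ m)
      (fun q : ℂ ↦ (∏' i : ℕ, (1 - q ^ (i + 1))) ^ m) atTop (Metric.ball 0 1) := by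
    induction m with
    | zero => simpa using tendstoLocallyUniformlyOn_of_eq_limit _ _ _
    | succ m ih =>
      simp_rw [pow_succ]
      exact ih.mul₀ h (hc.pow m) hc
  have hid := tendstoLocallyUniformlyOn_of_eq_limit (fun q : ℂ ↦ q) (atTop : Filter ℕ)
    (Metric.ball 0 1)
  refine ((hid.mul₀ (hpow 24) continuousOn_id (hc.pow 24)).congr fun N q _ ↦ ?_).congr_right
    fun q hq ↦ ?_
  · have := Finset.prod_Ico_add' (fun k ↦ (1 - q ^ k) ^ 24) 0 N 1
    rw [zero_add, Finset.Ico_add_one_right_eq_Icc, ← Finset.range_eq_Ico] at this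
    simp [← this, Finset.prod_pow]
  · simp [(multipliable_one_sub_pow (by simpa using hq)).tprod_pow 24]

lemma discriminant_qExpansion_coeff (n : ℕ) :
    (qExpansion 1 ModularForm.discriminant).coeff n = (ramanujanTau n : ℂ) := by
  rw [qExpansion_coeff, inv_mul_eq_iff_eq_mul₀ (by exact_mod_cast n.factorial_ne_zero)]
  have hev : cuspFunction 1 ModularForm.discriminant =ᶠ[𝓝 0]
      fun q ↦ q * ∏' i : ℕ, (1 - q ^ (i + 1)) ^ 24 :=
    discriminant_cuspFunction_eqOn.eventuallyEq_of_mem (Metric.ball_mem_nhds _ one_pos)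
  rw [hev.iteratedDeriv_eq]
  refine tendsto_nhds_unique ((tendstoLocallyUniformlyOn_mul_prod_one_sub_pow.iteratedDeriv
    (fun N ↦ by fun_prop) Metric.isOpen_ball n).tendsto_at (Metric.mem_ball_self one_pos)) ?_
  refine tendsto_const_nhds.congr' ?_
  filter_upwards [eventually_ge_atTop n] with N hN
  have := Polynomial.iteratedDeriv_eval_zero (((Polynomial.X : Polynomial ℤ) *
    ∏ k ∈ Finset.Icc 1 N, (1 - Polynomial.X ^ k) ^ 24).map (Int.castRingHom ℂ)) n
  rw [Polynomial.coeff_map, coeff_X_mul_prod_one_sub_X_pow hN] at this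
  simpa [Polynomial.eval_prod, Polynomial.map_prod] using this.symm

lemma qExpansion_E₈_eq_E₄_sq :
    qExpansion 1 (E (k := 8) (by norm_num)) = qExpansion 1 E₄ ^ 2 := by
  let f : ModularForm 𝒮ℒ (8 : ℕ) :=
    E (k := 8) (by norm_num) - ModularForm.mcast (by decide) (E₄.pow 2)
  have hq : qExpansion 1 f = qExpansion 1 (E (k := 8) (by norm_num)) - qExpansion 1 E₄ ^ 2 := by
    simp only [f, FunLike.coe_sub, coe_mcast,
      ModularForm.qExpansion_sub one_pos one_mem_strictPeriods_SL,
      ModularForm.qExpansion_pow one_pos one_mem_strictPeriods_SL]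
  have hf : f = 0 := by
    apply sturm_bound_levelOne_nat
    rw [hq]
    norm_num only [Nat.cast_zero]
    rw [pos_iff_ne_zero, PowerSeries.order_ne_zero_iff_constCoeff_eq_zero]
    have h4 := E_qExpansion_coeff_zero (k := 4) (by norm_num) ⟨2, rfl⟩
    have h8 := E_qExpansion_coeff_zero (k := 8) (by norm_num) ⟨4, rfl⟩
    rw [PowerSeries.coeff_zero_eq_constantCoeff] at h4 h8
    simp [h4, h8]
  rw [← sub_eq_zero, ← hq, hf]
  exact qExpansion_zero 1

lemma discriminant_qExpansion :
    (1728 : ℂ) • qExpansion 1 ModularForm.discriminant = qExpansion 1 E₄ *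
      qExpansion 1 (E (k := 8) (by norm_num)) - qExpansion 1 E₆ * qExpansion 1 E₆ := by
  have h : (1728 : ℂ) • (CuspForm.discriminant : ℍ → ℂ) = (E₄.pow 3 : ℍ → ℂ) - E₆.pow 2 := by
    rw [ModularForm.coe_pow, ModularForm.coe_pow]
    ext z
    simp [discriminant_eq_E₄_cube_sub_E₆_sq z, mul_div_cancel₀]
  rw [← CuspForm.coe_discriminant, ← ModularForm.qExpansion_smul one_pos one_mem_strictPeriods_SL,
    h, ModularForm.qExpansion_sub one_pos one_mem_strictPeriods_SL,
    ModularForm.qExpansion_pow one_pos one_mem_strictPeriods_SL,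
    ModularForm.qExpansion_pow one_pos one_mem_strictPeriods_SL, qExpansion_E₈_eq_E₄_sq]
  ring

lemma PowerSeries.coeff_mul_of_coeff_zero_eq_one {R : Type*} [CommSemiring R]
    {f g : PowerSeries R} (hf : f.coeff 0 = 1) (hg : g.coeff 0 = 1) {n : ℕ} (hn : 1 ≤ n) :
    (f * g).coeff n = g.coeff n + ∑ a ∈ Finset.Ico 1 n, f.coeff a * g.coeff (n - a) + f.coeff n := by
  rw [PowerSeries.coeff_mul, Finset.Nat.sum_antidiagonal_eq_sum_range_succ_mk,
    Finset.sum_range_succ, Finset.range_eq_Ico, Finset.sum_eq_sum_Ico_succ_bot (by lia)]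
  simp [hf, hg, -PowerSeries.coeff_zero_eq_constantCoeff]

lemma E_qExpansion_coeff_eq_sigmaPow {k : ℕ} (hk : 3 ≤ k) (hk2 : Even k) {m : ℕ} (hm : m ≠ 0) :
    (qExpansion 1 (E hk)).coeff m = -(2 * k / bernoulli k : ℂ) * sigmaPow (k - 1) m := by
  rw [E_qExpansion_coeff hk hk2, if_neg hm, ArithmeticFunction.sigma_apply, sigmaPow]

theorem tau_eq_convolution_of_divisor_sums (n : ℕ) (hn : 1 ≤ n) :
    (ramanujanTau n : ℚ)
      = (200 / 3 : ℚ) * ∑ a ∈ Finset.Ico 1 n, (sigmaPow 3 a : ℚ) * (sigmaPow 7 (n - a) : ℚ)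
        - 147 * ∑ a ∈ Finset.Ico 1 n, (sigmaPow 5 a : ℚ) * (sigmaPow 5 (n - a) : ℚ)
        + (5 / 18 : ℚ) * (sigmaPow 7 n : ℚ)
        + (7 / 12 : ℚ) * (sigmaPow 5 n : ℚ)
        + (5 / 36 : ℚ) * (sigmaPow 3 n : ℚ) := by
  have hE4 {m : ℕ} (hm : m ≠ 0) : (qExpansion 1 E₄).coeff m = 240 * (sigmaPow 3 m : ℂ) := by
    rw [E_qExpansion_coeff_eq_sigmaPow _ ⟨2, rfl⟩ hm, show bernoulli 4 = -1 / 30 by decide +kernel]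
    norm_num
  have hE6 {m : ℕ} (hm : m ≠ 0) : (qExpansion 1 E₆).coeff m = -504 * (sigmaPow 5 m : ℂ) := by
    rw [E_qExpansion_coeff_eq_sigmaPow _ ⟨3, rfl⟩ hm, show bernoulli 6 = 1 / 42 by decide +kernel]
    norm_num
  have hE8 {m : ℕ} (hm : m ≠ 0) : (qExpansion 1 (E (k := 8) (by norm_num))).coeff m =
      480 * (sigmaPow 7 m : ℂ) := by
    rw [E_qExpansion_coeff_eq_sigmaPow _ ⟨4, rfl⟩ hm, show bernoulli 8 = -1 / 30 by decide +kernel]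
    norm_num
  have h := congrArg (PowerSeries.coeff n) discriminant_qExpansion
  have h0 : n ≠ 0 := by lia
  rw [map_sub, PowerSeries.coeff_smul, discriminant_qExpansion_coeff,
    PowerSeries.coeff_mul_of_coeff_zero_eq_one (E_qExpansion_coeff_zero _ ⟨2, rfl⟩)
      (E_qExpansion_coeff_zero _ ⟨4, rfl⟩) hn,
    PowerSeries.coeff_mul_of_coeff_zero_eq_one (E_qExpansion_coeff_zero _ ⟨3, rfl⟩)
      (E_qExpansion_coeff_zero _ ⟨3, rfl⟩) hn, hE4 h0, hE6 h0, hE8 h0] at h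
  have h48 : ∑ a ∈ Finset.Ico 1 n, (qExpansion 1 E₄).coeff a *
      (qExpansion 1 (E (k := 8) (by norm_num))).coeff (n - a) =
      115200 * ∑ a ∈ Finset.Ico 1 n, (sigmaPow 3 a : ℂ) * (sigmaPow 7 (n - a) : ℂ) := by
    rw [Finset.mul_sum]
    refine Finset.sum_congr rfl fun a ha ↦ ?_
    rw [Finset.mem_Ico] at ha
    rw [hE4 (by lia), hE8 (by lia)]
    ring
  have h66 : ∑ a ∈ Finset.Ico 1 n, (qExpansion 1 E₆).coeff a *
      (qExpansion 1 E₆).coeff (n - a) =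
      254016 * ∑ a ∈ Finset.Ico 1 n, (sigmaPow 5 a : ℂ) * (sigmaPow 5 (n - a) : ℂ) := by
    rw [Finset.mul_sum]
    refine Finset.sum_congr rfl fun a ha ↦ ?_
    rw [Finset.mem_Ico] at ha
    rw [hE6 (by lia), hE6 (by lia)]
    ring
  rw [h48, h66, smul_eq_mul] at h
  apply Rat.cast_injective (α := ℂ)
  push_cast
  linear_combination h / 1728
end

section
/- For every integer n ≥ 2, the fourth crank moment satisfies Σ_{λ ⊢ n} crank(λ)^4 = 2·Σ_{a=0}^{n-1} p(a)·(12·σ_{(1,1)}(n−a) + 2·σ_3(n−a) − σ_1(n−a)). -/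
open Finset

/-- The number of partitions of `n` (with `p 0 = 1`). -/
def partitionCount (n : ℕ) : ℕ := Fintype.card (Nat.Partition n)

/-- The Andrews–Garvan crank of a partition: the largest part if there are no ones, and
otherwise the number of parts larger than the number of ones minus the number of ones. -/
def crank {n : ℕ} (lam : n.Partition) : ℤ :=
  if lam.parts.count 1 = 0 then (lam.parts.sup : ℤ)
  else ((lam.parts.filter (fun x => lam.parts.count 1 < x)).card : ℤ)
    - (lam.parts.count 1 : ℤ)

open PowerSeries

section QBinomial

variable {Q : Type*} [CommRing Q]

/-- Truncated functional equation behind the `q`-binomial theorem. -/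
lemma one_sub_mul_sum_sub {q a : Q} {A : ℕ → Q}
    (hA : ∀ k, A (k + 1) * (1 - q ^ (k + 1)) = A k * (1 - a * q ^ k)) (t : Q) (K : ℕ) :
    (1 - t) * ∑ k ∈ range K, A k * t ^ k - (1 - a * t) * ∑ k ∈ range K, A k * (t * q) ^ k
      = -(A K * (1 - q ^ K) * t ^ K) := by
  induction K with
  | zero => simp
  | succ K ih =>
    rw [hA, sum_range_succ, sum_range_succ]
    linear_combination ih

/-- The `q`-binomial theorem in a ring where `q` is nilpotent. -/
lemma qBinomial_of_pow_eq_zero {q : Q} {N : ℕ} (hq : q ^ (N + 1) = 0) (a u : Q) {r : ℕ → Q}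
    (hr : ∀ i, 1 ≤ i → (1 - q ^ i) * r i = 1) :
    (∑ k ∈ range (N + 1), (∏ i ∈ range k, (1 - a * q ^ i)) * (∏ i ∈ Icc 1 k, r i) * (u * q) ^ k)
      * ∏ j ∈ Icc 1 N, (1 - u * q ^ j) = ∏ j ∈ Icc 1 N, (1 - a * u * q ^ j) := by
  set A : ℕ → Q := fun k => (∏ i ∈ range k, (1 - a * q ^ i)) * ∏ i ∈ Icc 1 k, r i with hAdef
  have hA : ∀ k, A (k + 1) * (1 - q ^ (k + 1)) = A k * (1 - a * q ^ k) := by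
    intro k
    simp only [hAdef, prod_range_succ, prod_Icc_succ_top (Nat.le_add_left 1 k)]
    linear_combination (∏ i ∈ range k, (1 - a * q ^ i)) * (1 - a * q ^ k) *
      (∏ i ∈ Icc 1 k, r i) * hr (k + 1) (by omega)
  have hstep : ∀ j, 1 ≤ j → (1 - u * q ^ j) * ∑ k ∈ range (N + 1), A k * (u * q ^ j) ^ k
      = (1 - a * u * q ^ j) * ∑ k ∈ range (N + 1), A k * (u * q ^ (j + 1)) ^ k := by
    intro j hj
    have h := one_sub_mul_sum_sub hA (u * q ^ j) (N + 1)
    have h0 : (u * q ^ j) ^ (N + 1) = 0 := by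
      rw [mul_pow, ← pow_mul, mul_comm j, pow_mul, hq, zero_pow (by omega), mul_zero]
    rw [h0, mul_zero, neg_zero, sub_eq_zero] at h
    simpa only [pow_succ q j, mul_assoc] using h
  have hiter : ∀ m, (∑ k ∈ range (N + 1), A k * (u * q) ^ k) * ∏ j ∈ Icc 1 m, (1 - u * q ^ j)
      = (∏ j ∈ Icc 1 m, (1 - a * u * q ^ j)) *
        ∑ k ∈ range (N + 1), A k * (u * q ^ (m + 1)) ^ k := by
    intro m
    induction m with
    | zero => simp
    | succ m ih =>
      rw [prod_Icc_succ_top (by omega), prod_Icc_succ_top (by omega), ← mul_assoc, ih]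
      linear_combination (∏ j ∈ Icc 1 m, (1 - a * u * q ^ j)) * hstep (m + 1) (by omega)
  rw [hiter N, hq, sum_range_succ']
  simp [hAdef]

/-- The crank generating identity in a ring where `q` is nilpotent: the left-hand side sorts
partitions by their number of ones, or by their largest part when there are no ones. -/
lemma crank_identity_of_pow_eq_zero {q u u' : Q} {N : ℕ} (hN : 1 ≤ N) (hq : q ^ (N + 1) = 0)
    (huu : u * u' = 1) {r s s' : ℕ → Q} (hr : ∀ i, 1 ≤ i → (1 - q ^ i) * r i = 1)
    (hs : ∀ i, 1 ≤ i → (1 - u * q ^ i) * s i = 1)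
    (hs' : ∀ i, 1 ≤ i → (1 - u' * q ^ i) * s' i = 1) :
    ∑ n ∈ Icc 1 N, u' ^ n * q ^ n * ((∏ i ∈ Icc 2 n, r i) * ∏ i ∈ Icc (n + 1) N, s i)
      + ∑ k ∈ Icc 2 N, u ^ k * (q ^ k * ∏ i ∈ Icc 2 k, r i) + ((1 - q) + u * q)
      = ∏ i ∈ Icc 1 N, ((1 - q ^ i) * s i * s' i) := by
  have hR : ∀ k, 1 ≤ k → (1 - q) * ∏ i ∈ Icc 1 k, r i = ∏ i ∈ Icc 2 k, r i := by
    intro k hk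
    rw [← mul_prod_Ioc_eq_prod_Icc hk, ← mul_assoc, ← pow_one q, hr 1 le_rfl, one_mul]
    rfl
  have hS : (∏ i ∈ Icc 1 N, (1 - u * q ^ i)) * ∏ i ∈ Icc 1 N, s i = 1 := by
    rw [← prod_mul_distrib]
    exact prod_eq_one fun i hi => hs i (mem_Icc.1 hi).1
  have hS' : (∏ i ∈ Icc 1 N, (1 - u' * q ^ i)) * ∏ i ∈ Icc 1 N, s' i = 1 := by
    rw [← prod_mul_distrib]
    exact prod_eq_one fun i hi => hs' i (mem_Icc.1 hi).1
  have hSn : ∀ n, n ≤ N → (∏ i ∈ range n, (1 - u * q * q ^ i)) * ∏ i ∈ Icc 1 N, s i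
      = ∏ i ∈ Icc (n + 1) N, s i := by
    intro n hn
    induction n with
    | zero => simp
    | succ n ih =>
      rw [prod_range_succ]
      have h1 := ih (by omega)
      rw [← mul_prod_Ioc_eq_prod_Icc hn] at h1
      have h2 := hs (n + 1) (by omega)
      have h3 : Ioc (n + 1) N = Icc (n + 1 + 1) N := (Icc_add_one_left_eq_Ioc _ _).symm
      rw [h3] at h1
      rw [pow_succ'] at h2
      linear_combination (1 - u * q * q ^ n) * h1 + (∏ i ∈ Icc (n + 1 + 1) N, s i) * h2
  have hsplit : ∀ f : ℕ → Q, ∑ k ∈ range (N + 1), f k = f 0 + ∑ k ∈ Icc 1 N, f k := by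
    intro f
    rw [sum_range_eq_add_Ico _ (by omega)]
    rfl
  have e1 := qBinomial_of_pow_eq_zero hq 0 u hr
  have e2 := qBinomial_of_pow_eq_zero hq (u * q) u' hr
  have e3 : (1 - q) * ∏ j ∈ Icc 1 N, (1 - u * q * u' * q ^ j) = ∏ j ∈ Icc 1 N, (1 - q ^ j) := by
    have h : ∀ m, (1 - q) * ∏ j ∈ Icc 1 m, (1 - u * q * u' * q ^ j)
        = (∏ j ∈ Icc 1 m, (1 - q ^ j)) * (1 - q ^ (m + 1)) := by
      intro m
      induction m with
      | zero => simp
      | succ m ih =>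
        rw [prod_Icc_succ_top (by omega), prod_Icc_succ_top (by omega), ← mul_assoc, ih]
        have : u * q * u' * q ^ (m + 1) = q ^ (m + 1 + 1) := by
          rw [pow_succ' q (m + 1)]
          linear_combination (q * q ^ (m + 1)) * huu
        rw [this]
    rw [h N, hq, sub_zero, mul_one]
  simp only [zero_mul, sub_zero, prod_const_one, one_mul] at e1
  have e1' : (1 - q) * ∏ i ∈ Icc 1 N, s i
      = (1 - q) + u * q + ∑ k ∈ Icc 2 N, u ^ k * (q ^ k * ∏ i ∈ Icc 2 k, r i) := by
    have h : ∏ i ∈ Icc 1 N, s i = ∑ k ∈ range (N + 1), (∏ i ∈ Icc 1 k, r i) * (u * q) ^ k := by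
      linear_combination (-∏ i ∈ Icc 1 N, s i) * e1 +
        (∑ k ∈ range (N + 1), (∏ i ∈ Icc 1 k, r i) * (u * q) ^ k) * hS
    rw [h, hsplit, ← add_sum_Ioc_eq_sum_Icc hN, mul_add, mul_add, mul_sum]
    have h1 := hR 1 le_rfl
    have h2 : Ioc 1 N = Icc 2 N := rfl
    rw [h2]
    have h3 : ∑ k ∈ Icc 2 N, (1 - q) * ((∏ i ∈ Icc 1 k, r i) * (u * q) ^ k)
        = ∑ k ∈ Icc 2 N, u ^ k * (q ^ k * ∏ i ∈ Icc 2 k, r i) := by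
      refine sum_congr rfl fun k hk => ?_
      rw [← hR k (by have := (mem_Icc.1 hk).1; omega)]
      ring
    rw [h3]
    simp only [Icc_self, prod_singleton] at h1
    simp at h1 ⊢
    linear_combination (u * q) * h1
  have e2' : ∑ n ∈ Icc 1 N, u' ^ n * q ^ n * ((∏ i ∈ Icc 2 n, r i) * ∏ i ∈ Icc (n + 1) N, s i)
      + (1 - q) * ∏ i ∈ Icc 1 N, s i = (1 - q) * (∏ i ∈ Icc 1 N, s i) *
        ∑ k ∈ range (N + 1), (∏ i ∈ range k, (1 - u * q * q ^ i)) * (∏ i ∈ Icc 1 k, r i)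
          * (u' * q) ^ k := by
    rw [hsplit, mul_add, add_comm, mul_sum]
    congr 1
    · simp
    refine sum_congr rfl fun n hn => ?_
    obtain ⟨h1, h2⟩ := mem_Icc.1 hn
    rw [← hSn n h2, ← hR n h1]
    ring
  rw [prod_mul_distrib, prod_mul_distrib]
  linear_combination e2' - e1' +
    (1 - q) * (∏ i ∈ Icc 1 N, s i) * (∏ i ∈ Icc 1 N, s' i) * e2
    + (∏ i ∈ Icc 1 N, s i) * (∏ i ∈ Icc 1 N, s' i) * e3
    - (1 - q) * (∏ i ∈ Icc 1 N, s i) * (∑ k ∈ range (N + 1),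
      (∏ i ∈ range k, (1 - u * q * q ^ i)) * (∏ i ∈ Icc 1 k, r i) * (u' * q) ^ k) * hS'

end QBinomial

section PartitionSeries

variable {R : Type*}

/-- The Euler factor of `Nat.Partition.genFun f` at parts of size `i`. -/
noncomputable def eulerFactor [CommSemiring R] (f : ℕ → ℕ → R) (i : ℕ) : R⟦X⟧ :=
  PowerSeries.mk fun n => if i ∣ n then (if n = 0 then 1 else f i (n / i)) else 0

/-- The geometric series `∑ₘ wᵐ Xⁱᵐ`. -/
noncomputable def geomSeries [CommSemiring R] (w : R) (i : ℕ) : R⟦X⟧ :=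
  PowerSeries.mk fun n => if i ∣ n then w ^ (n / i) else 0

lemma eulerFactor_eq_geomSeries [CommSemiring R] {f : ℕ → ℕ → R} {i : ℕ} {w : R}
    (h : ∀ c, f i c = w ^ c) : eulerFactor f i = geomSeries w i := by
  ext n
  simp only [eulerFactor, geomSeries, coeff_mk, h]
  split_ifs with h1 h2
  · simp [h2]
  · rfl
  · rfl

lemma eulerFactor_eq_one [CommSemiring R] {f : ℕ → ℕ → R} {i : ℕ} (h : ∀ c, f i c = 0) :
    eulerFactor f i = 1 := by
  ext n
  simp only [eulerFactor, coeff_mk, h, coeff_one]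
  split_ifs with h1 h2 h2
  · rfl
  · rfl
  · simp [h2] at h1
  · rfl

lemma eulerFactor_one_single [CommSemiring R] {f : ℕ → ℕ → R} {n : ℕ} (hn : 1 ≤ n) {a : R}
    (h : ∀ c, f 1 c = if c = n then a else 0) : eulerFactor f 1 = 1 + C a * X ^ n := by
  ext m
  simp only [eulerFactor, coeff_mk, h, map_add, coeff_one, coeff_C_mul, coeff_X_pow]
  have : ¬ 0 = n := by omega
  by_cases h1 : m = 0 <;> simp [h1, this]

lemma one_sub_mul_geomSeries [CommRing R] (w : R) {i : ℕ} (hi : 1 ≤ i) :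
    (1 - C w * X ^ i) * geomSeries w i = 1 := by
  ext n
  rw [sub_mul, one_mul, map_sub, mul_assoc, coeff_C_mul, coeff_X_pow_mul', coeff_one]
  simp only [geomSeries, coeff_mk]
  by_cases h0 : n = 0
  · subst h0
    simp
    omega
  · by_cases hd : i ∣ n
    · obtain ⟨c, rfl⟩ := hd
      obtain ⟨c, rfl⟩ : ∃ d, c = d + 1 := Nat.exists_eq_succ_of_ne_zero (by rintro rfl; simp at h0)
      have h1 : i ≤ i * (c + 1) := Nat.le_mul_of_pos_right _ (by omega)
      have h2 : i * (c + 1) - i = i * c := by rw [mul_add, mul_one, Nat.add_sub_cancel]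
      rw [if_pos (dvd_mul_right _ _), if_pos h1, h2, if_pos (dvd_mul_right _ _), if_neg h0,
        Nat.mul_div_cancel_left _ hi, Nat.mul_div_cancel_left _ hi, pow_succ']
      ring
    · rw [if_neg hd, if_neg h0]
      by_cases h1 : i ≤ n
      · have h2 : ¬ i ∣ n - i := fun h => hd ((Nat.dvd_sub_iff_left h1 dvd_rfl).1 h)
        simp [h2]
      · simp [h1]

open scoped PowerSeries.WithPiTopology in
/-- Euler product of a partition generating function with finitely many nontrivial factors. -/
lemma genFun_eq_prod_eulerFactor [CommRing R] {f : ℕ → ℕ → R} {s : Finset ℕ} (hs : 0 ∉ s)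
    (hf : ∀ i, i ∉ s → ∀ c, f i c = 0) :
    Nat.Partition.genFun f = ∏ i ∈ s, eulerFactor f i := by
  let _ : TopologicalSpace R := ⊥
  have _ : DiscreteTopology R := ⟨rfl⟩
  have key : ∀ i, i ≠ 0 → (1 : R⟦X⟧) + ∑' j, f i (j + 1) • X ^ (i * (j + 1))
      = eulerFactor f i := by
    intro i hi
    ext n
    rw [map_add, (Nat.Partition.summable_genFun_term' f hi).map_tsum _
      (WithPiTopology.continuous_coeff _ _)]
    simp only [eulerFactor, coeff_mk, coeff_one, map_smul, coeff_X_pow,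
      smul_eq_mul, mul_ite, mul_one, mul_zero]
    by_cases hd : i ∣ n
    · obtain ⟨c, rfl⟩ := hd
      rcases c with _ | c
      · simp [hi]
      · rw [tsum_eq_single c]
        · simp [hi, Nat.mul_div_cancel_left _ (Nat.pos_of_ne_zero hi)]
        · intro b hb
          rw [if_neg]
          intro h
          have := Nat.eq_of_mul_eq_mul_left (Nat.pos_of_ne_zero hi) h
          omega
    · have h0 : n ≠ 0 := by rintro rfl; simp at hd
      have : ∀ j, ¬ n = i * (j + 1) := fun j h => hd ⟨_, h⟩
      simp [hd, h0, this]
  have h1 := Nat.Partition.genFun_eq_tprod f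
  simp_rw [fun i => key (i + 1) (Nat.succ_ne_zero i)] at h1
  have h2 : s = (s.image Nat.pred).map (addRightEmbedding 1) := by
    ext i
    simp only [mem_map, mem_image, addRightEmbedding_apply]
    constructor
    · intro hi
      have : i ≠ 0 := by rintro rfl; exact hs hi
      exact ⟨i - 1, ⟨i, hi, rfl⟩, by omega⟩
    · rintro ⟨a, ⟨b, hb, rfl⟩, rfl⟩
      have : b ≠ 0 := by rintro rfl; exact hs hb
      rwa [show b.pred + 1 = b by simp; omega]
  rw [h1, h2, prod_map, tprod_eq_prod]
  · rfl
  · intro b hb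
    refine eulerFactor_eq_one (hf _ fun h => hb ?_)
    exact mem_image.2 ⟨b + 1, h, rfl⟩

/-- Parts weighted multiplicatively, except that exactly `n` ones are required. -/
lemma prod_ones_eq [CommRing R] {N n : ℕ} (lam : N.Partition) (hn : 1 ≤ n) (z a : R) :
    lam.parts.toFinsupp.prod (fun i c => if i ∈ Icc 1 N then
        (if i = 1 then (if c = n then a else 0) else (if i ≤ n then 1 else z) ^ c) else 0)
      - lam.parts.toFinsupp.prod (fun i c => if i ∈ Icc 2 N then (if i ≤ n then 1 else z) ^ c
          else 0)
      = if lam.parts.count 1 = n then a * z ^ (lam.parts.filter (fun x => n < x)).card else 0 := by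
  have hmem : ∀ i ∈ lam.parts.toFinset, i ∈ Icc 1 N := fun i hi =>
    mem_Icc.2 ⟨lam.parts_pos (Multiset.mem_toFinset.1 hi),
      Nat.Partition.le_of_mem_parts (Multiset.mem_toFinset.1 hi)⟩
  simp only [Finsupp.prod, Multiset.toFinsupp_support, Multiset.toFinsupp_apply]
  by_cases h1 : 1 ∈ lam.parts.toFinset
  · rw [prod_eq_zero (f := fun i => if i ∈ Icc 2 N then (if i ≤ n then 1 else z) ^
      (Multiset.count i lam.parts) else 0) h1 (by simp), sub_zero]
    have hz : z ^ (lam.parts.filter (fun x => n < x)).card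
        = ∏ i ∈ lam.parts.toFinset, (if i ≤ n then 1 else z) ^ (lam.parts.count i) := by
      rw [← Finset.prod_multiset_map_count]
      generalize lam.parts = m
      induction m using Multiset.induction_on with
      | empty => simp
      | cons x m ih =>
        rw [Multiset.map_cons, Multiset.prod_cons, ← ih]
        by_cases hx : n < x
        · rw [Multiset.filter_cons_of_pos _ hx, Multiset.card_cons, pow_succ', if_neg (by omega)]
        · rw [Multiset.filter_cons_of_neg _ hx, if_pos (by omega), one_mul]
    have : ∏ i ∈ lam.parts.toFinset, (if i ∈ Icc 1 N then (if i = 1 then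
        (if lam.parts.count i = n then a else 0) else (if i ≤ n then 1 else z) ^
          lam.parts.count i) else 0)
        = ∏ i ∈ lam.parts.toFinset, ((if i = 1 then (if lam.parts.count 1 = n then a else 0) else 1)
          * (if i ≤ n then 1 else z) ^ lam.parts.count i) := by
      refine prod_congr rfl fun i hi => ?_
      rw [if_pos (hmem i hi)]
      by_cases hi1 : i = 1
      · subst hi1
        simp [hn]
      · simp [hi1]
    refine this.trans ?_
    rw [prod_mul_distrib, prod_ite_eq', if_pos h1, ← hz]
    split_ifs <;> simp
  · have h0 : lam.parts.count 1 = 0 := by simpa using h1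
    rw [if_neg (by omega), sub_eq_zero]
    refine prod_congr rfl fun i hi => ?_
    have hi1 : i ≠ 1 := by rintro rfl; exact h1 hi
    have := hmem i hi
    rw [if_pos this, if_neg hi1, if_pos (show i ∈ Icc 2 N by simp at this ⊢; omega)]

lemma prod_restricted_eq [CommRing R] {N : ℕ} (lam : N.Partition) (k : ℕ) :
    lam.parts.toFinsupp.prod (fun i _ => if i ∈ Icc 2 k then (1 : R) else 0)
      = if lam.parts.count 1 = 0 ∧ lam.parts.sup ≤ k then 1 else 0 := by
  simp only [Finsupp.prod, Multiset.toFinsupp_support, prod_boole]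
  congr 1
  simp only [Multiset.mem_toFinset, mem_Icc, Multiset.sup_le, Multiset.count_eq_zero, eq_iff_iff]
  constructor
  · intro h
    exact ⟨fun h1 => by simpa using (h 1 h1).1, fun b hb => (h b hb).2⟩
  · rintro ⟨h1, h2⟩ i hi
    have := lam.parts_pos hi
    have : i ≠ 1 := by rintro rfl; exact h1 hi
    exact ⟨by omega, h2 i hi⟩

/-- The crank weight of a partition of `N ≥ 1`, split by number of ones and by largest part. -/
lemma crank_weight_eq [CommRing R] {N : ℕ} (hN : 1 ≤ N) (lam : N.Partition) (u : Rˣ) :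
    ((u ^ crank lam : Rˣ) : R) =
      ∑ n ∈ Icc 1 N, (lam.parts.toFinsupp.prod (fun i c => if i ∈ Icc 1 N then
        (if i = 1 then (if c = n then (↑u⁻¹ : R) ^ n else 0)
          else (if i ≤ n then 1 else (u : R)) ^ c)
          else 0)
      - lam.parts.toFinsupp.prod (fun i c => if i ∈ Icc 2 N then
        (if i ≤ n then 1 else (u : R)) ^ c else 0))
      + ∑ k ∈ Icc 2 N, (u : R) ^ k *
        (lam.parts.toFinsupp.prod (fun i _ => if i ∈ Icc 2 k then (1 : R) else 0)
        - lam.parts.toFinsupp.prod (fun i _ => if i ∈ Icc 2 (k - 1) then (1 : R) else 0)) := by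
  rw [sum_congr rfl fun n hn => prod_ones_eq lam (mem_Icc.1 hn).1 (u : R) ((↑u⁻¹ : R) ^ n)]
  simp only [prod_restricted_eq]
  by_cases h0 : lam.parts.count 1 = 0
  · rw [sum_eq_zero, zero_add]
    swap
    · intro n hn
      have := (mem_Icc.1 hn).1
      rw [if_neg (by omega)]
    have hne : lam.parts ≠ 0 := by
      intro h
      have := lam.parts_sum
      simp [h] at this
      omega
    obtain ⟨x, hx⟩ := Multiset.exists_mem_of_ne_zero hne
    have hx1 : x ≠ 1 := by rintro rfl; exact (Multiset.count_eq_zero.1 h0) hx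
    have hx0 := lam.parts_pos hx
    have hx2 : x ≤ lam.parts.sup := Multiset.le_sup hx
    have hsup : lam.parts.sup ≤ N := Multiset.sup_le.2 fun b hb =>
      Nat.Partition.le_of_mem_parts hb
    rw [sum_eq_single_of_mem lam.parts.sup (mem_Icc.2 ⟨by omega, hsup⟩)]
    · rw [if_pos ⟨h0, le_rfl⟩, if_neg (by omega), crank, if_pos h0]
      simp
    · intro k hk hks
      have := mem_Icc.1 hk
      by_cases h : lam.parts.sup ≤ k
      · rw [if_pos ⟨h0, h⟩, if_pos ⟨h0, by omega⟩, sub_self, mul_zero]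
      · rw [if_neg (by tauto), if_neg (by omega), sub_self, mul_zero]
  · have h1 : lam.parts.count 1 ≤ N := by
      calc lam.parts.count 1 ≤ lam.parts.card := Multiset.count_le_card _ _
        _ ≤ lam.parts.sum := by
          have := Multiset.card_nsmul_le_sum (s := lam.parts) (a := 1)
            (fun x hx => lam.parts_pos hx)
          simpa using this
        _ = N := lam.parts_sum
    simp only [h0, false_and, if_false, sub_self, mul_zero, sum_const_zero, add_zero]
    rw [sum_ite_eq, if_pos (mem_Icc.2 ⟨by omega, h1⟩), crank, if_neg h0, sub_eq_add_neg,
      zpow_add, zpow_natCast, zpow_neg, zpow_natCast, Units.val_mul, ← inv_pow,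
      Units.val_pow_eq_pow_val, Units.val_pow_eq_pow_val, mul_comm]

end PartitionSeries

section CrankSeries

variable {R : Type*} [CommRing R]

lemma genFun_ones_sub {N n : ℕ} (hn : 1 ≤ n) (hnN : n ≤ N) (z a : R) :
    Nat.Partition.genFun (fun i c => if i ∈ Icc 1 N then
        (if i = 1 then (if c = n then a else 0) else (if i ≤ n then 1 else z) ^ c) else 0)
      - Nat.Partition.genFun (fun i c => if i ∈ Icc 2 N then (if i ≤ n then 1 else z) ^ c else 0)
      = C a * X ^ n * ((∏ i ∈ Icc 2 n, geomSeries 1 i) * ∏ i ∈ Icc (n + 1) N, geomSeries z i) := by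
  rw [genFun_eq_prod_eulerFactor (s := Icc 1 N) (by simp) (fun i hi c => if_neg hi),
    genFun_eq_prod_eulerFactor (s := Icc 2 N) (by simp) (fun i hi c => if_neg hi),
    ← mul_prod_Ioc_eq_prod_Icc (hn.trans hnN),
    eulerFactor_one_single hn (a := a) (fun c => by simp [hn.trans hnN])]
  have h2 : ∀ m k : ℕ, Icc (m + 1) k = Ioc m k := fun m k => Icc_add_one_left_eq_Ioc m k
  rw [h2 1 N, h2 1 n, h2 n N]
  have h3 : ∏ i ∈ Ioc 1 N, eulerFactor (fun i c => if i ∈ Icc 1 N then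
        (if i = 1 then (if c = n then a else 0) else (if i ≤ n then 1 else z) ^ c) else 0) i
      = ∏ i ∈ Ioc 1 N, geomSeries (if i ≤ n then 1 else z) i := by
    refine prod_congr rfl fun i hi => eulerFactor_eq_geomSeries fun c => ?_
    have := mem_Ioc.1 hi
    rw [if_pos (mem_Icc.2 (by omega)), if_neg (by omega)]
  have h4 : ∏ i ∈ Ioc 1 N, eulerFactor (fun i c => if i ∈ Ioc 1 N then
        (if i ≤ n then 1 else z) ^ c else 0) i
      = ∏ i ∈ Ioc 1 N, geomSeries (if i ≤ n then 1 else z) i :=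
    prod_congr rfl fun i hi => eulerFactor_eq_geomSeries fun c => if_pos hi
  have h5 : ∏ i ∈ Ioc 1 N, geomSeries (if i ≤ n then 1 else z) i
      = (∏ i ∈ Ioc 1 n, geomSeries 1 i) * ∏ i ∈ Ioc n N, geomSeries z i := by
    rw [← prod_Ioc_consecutive _ hn hnN]
    congr 1
    · exact prod_congr rfl fun i hi => by rw [if_pos (mem_Ioc.1 hi).2]
    · exact prod_congr rfl fun i hi => by rw [if_neg (by have := (mem_Ioc.1 hi).1; omega)]
  rw [h3, h4, h5]
  ring

lemma genFun_restricted (k : ℕ) :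
    Nat.Partition.genFun (fun i _ => if i ∈ Icc 2 k then (1 : R) else 0)
      = ∏ i ∈ Icc 2 k, geomSeries 1 i := by
  rw [genFun_eq_prod_eulerFactor (s := Icc 2 k) (by simp) (fun i hi c => if_neg hi)]
  exact prod_congr rfl fun i hi => eulerFactor_eq_geomSeries fun c => by rw [if_pos hi, one_pow]

lemma genFun_restricted_sub {k : ℕ} (hk : 2 ≤ k) :
    Nat.Partition.genFun (fun i _ => if i ∈ Icc 2 k then (1 : R) else 0)
      - Nat.Partition.genFun (fun i _ => if i ∈ Icc 2 (k - 1) then (1 : R) else 0)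
      = X ^ k * ∏ i ∈ Icc 2 k, geomSeries 1 i := by
  rw [genFun_restricted, genFun_restricted]
  obtain ⟨k, rfl⟩ : ∃ m, k = m + 1 := ⟨k - 1, by omega⟩
  rw [Nat.add_sub_cancel, prod_Icc_succ_top hk]
  have := one_sub_mul_geomSeries (1 : R) (i := k + 1) (by omega)
  rw [map_one, one_mul] at this
  linear_combination (∏ i ∈ Icc 2 k, geomSeries (1 : R) i) * this

/-- The (truncated) crank generating function. -/
noncomputable def crankSeries (N : ℕ) (u : Rˣ) : R⟦X⟧ :=
  ∏ i ∈ Icc 1 N, ((1 - X ^ i) * geomSeries (u : R) i * geomSeries (↑u⁻¹ : R) i)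

lemma coeff_crankSeries {N : ℕ} (hN : 2 ≤ N) (u : Rˣ) :
    coeff N (crankSeries N u) = ∑ lam : N.Partition, ((u ^ crank lam : Rˣ) : R) := by
  let S : R⟦X⟧ := ∑ n ∈ Icc 1 N, C (↑u⁻¹ : R) ^ n * X ^ n *
      ((∏ i ∈ Icc 2 n, geomSeries 1 i) * ∏ i ∈ Icc (n + 1) N, geomSeries (u : R) i)
    + ∑ k ∈ Icc 2 N, C (u : R) ^ k * (X ^ k * ∏ i ∈ Icc 2 k, geomSeries 1 i)
  have hS : ∑ lam : N.Partition, ((u ^ crank lam : Rˣ) : R) = coeff N S := by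
    rw [sum_congr rfl fun lam _ => crank_weight_eq (by omega) lam u, sum_add_distrib, sum_comm,
      sum_comm (t := Icc 2 N), map_add, map_sum, map_sum]
    congr 1
    · refine sum_congr rfl fun n hn => ?_
      obtain ⟨h1, h2⟩ := mem_Icc.1 hn
      rw [sum_sub_distrib, ← map_pow C, ← genFun_ones_sub h1 h2, map_sub,
        Nat.Partition.coeff_genFun, Nat.Partition.coeff_genFun]
    · refine sum_congr rfl fun k hk => ?_
      rw [← mul_sum, sum_sub_distrib, ← map_pow C, ← genFun_restricted_sub (mem_Icc.1 hk).1,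
        coeff_C_mul, map_sub, Nat.Partition.coeff_genFun, Nat.Partition.coeff_genFun]
  let I : Ideal R⟦X⟧ := Ideal.span {X ^ (N + 1)}
  let π := Ideal.Quotient.mk I
  have hq : π X ^ (N + 1) = 0 := by
    rw [← map_pow, Ideal.Quotient.eq_zero_iff_mem]
    exact Ideal.mem_span_singleton_self _
  have hinv : ∀ w : R, ∀ i, 1 ≤ i → (1 - π (C w) * π X ^ i) * π (geomSeries w i) = 1 := by
    intro w i hi
    simpa using congrArg π (one_sub_mul_geomSeries w hi)
  have key := crank_identity_of_pow_eq_zero (q := π X) (u := π (C (u : R)))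
    (u' := π (C (↑u⁻¹ : R))) (show 1 ≤ N by omega) hq (by rw [← map_mul, ← map_mul]; simp)
    (r := fun i => π (geomSeries 1 i)) (by simpa using hinv 1) (hinv u) (hinv _)
  have h : π (S + ((1 - X) + C (u : R) * X)) = π (crankSeries N u) := by
    simpa only [S, crankSeries, map_add, map_sum, map_mul, map_pow, map_prod, map_sub, map_one]
      using key
  rw [Ideal.Quotient.eq, Ideal.mem_span_singleton, X_pow_dvd_iff] at h
  have h := h N (by omega)
  rw [map_sub, sub_eq_zero, map_add] at h
  rw [hS, ← h]
  have h1 : N ≠ 1 := by omega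
  have h0 : N ≠ 0 := by omega
  simp [coeff_one, coeff_X, h1, h0]

lemma coeff_prod_geomSeries_one {m N : ℕ} (hm : m ≤ N) :
    coeff m (∏ i ∈ Icc 1 N, geomSeries (1 : R) i) = partitionCount m := by
  have h : Nat.Partition.genFun (fun i _ => if i ∈ Icc 1 N then (1 : R) else 0)
      = ∏ i ∈ Icc 1 N, geomSeries 1 i := by
    rw [genFun_eq_prod_eulerFactor (s := Icc 1 N) (by simp) (fun i hi c => if_neg hi)]
    exact prod_congr rfl fun i hi => eulerFactor_eq_geomSeries fun c => by rw [if_pos hi, one_pow]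
  rw [← h, Nat.Partition.coeff_genFun, partitionCount, Fintype.card_eq_sum_ones, Nat.cast_sum]
  refine sum_congr rfl fun lam _ => ?_
  rw [Nat.cast_one, Finsupp.prod]
  refine prod_eq_one fun i hi => if_pos ?_
  have hi : i ∈ lam.parts := by simpa using hi
  exact mem_Icc.2 ⟨lam.parts_pos hi, (Nat.Partition.le_of_mem_parts hi).trans hm⟩

end CrankSeries

section DivisorSums

lemma two_mul_sum_antidiagonal_snd (e : ℕ) :
    2 * ∑ p ∈ antidiagonal e, (p.2 : ℤ) = e * (e + 1) := by
  induction e with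
  | zero => simp
  | succ e ih =>
    rw [Nat.sum_antidiagonal_succ, mul_add, ih]
    push_cast
    ring

lemma six_mul_sum_antidiagonal_mul (e : ℕ) :
    6 * ∑ p ∈ antidiagonal e, (p.1 : ℤ) * p.2 = (e : ℤ) ^ 3 - e := by
  induction e with
  | zero => simp
  | succ e ih =>
    rw [Nat.sum_antidiagonal_succ]
    have : ∑ p ∈ antidiagonal e, (((p.1 + 1 : ℕ) : ℤ) * p.2)
        = ∑ p ∈ antidiagonal e, (p.1 : ℤ) * p.2 + ∑ p ∈ antidiagonal e, (p.2 : ℤ) := by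
      rw [← sum_add_distrib]
      exact sum_congr rfl fun p _ => by push_cast; ring
    rw [this]
    have h := two_mul_sum_antidiagonal_snd e
    push_cast
    linear_combination ih + 3 * h

lemma sigmaPow_one_eq_sum {x b : ℕ} (hx : x ≤ b) :
    (sigmaPow 1 x : ℤ) = ∑ m ∈ Icc 1 b, ∑ n ∈ Icc 1 b, if m * n = x then (m : ℤ) else 0 := by
  have h : ∑ d ∈ x.divisors, (d : ℤ) = ∑ p ∈ x.divisorsAntidiagonal, (p.1 : ℤ) :=
    (Nat.sum_divisorsAntidiagonal fun d _ => (d : ℤ)).symm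
  rw [sigmaPow]
  push_cast
  simp only [pow_one]
  rw [h, ← sum_product', ← sum_filter]
  by_cases hx0 : x = 0
  · subst hx0
    rw [filter_eq_empty_iff.2]
    · simp
    · intro p hp
      simp only [mem_product, mem_Icc] at hp
      have : 0 < p.1 * p.2 := Nat.mul_pos hp.1.1 hp.2.1
      omega
  refine sum_congr ?_ fun _ _ => rfl
  ext ⟨m, n⟩
  simp only [Nat.mem_divisorsAntidiagonal, mem_filter, mem_product, mem_Icc]
  constructor
  · rintro ⟨rfl, h0⟩
    have hm : m ≠ 0 := by rintro rfl; simp at h0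
    have hn : n ≠ 0 := by rintro rfl; simp at h0
    have h1 : m ≤ m * n := Nat.le_mul_of_pos_right _ (by omega)
    have h2 : n ≤ m * n := Nat.le_mul_of_pos_left _ (by omega)
    omega
  · rintro ⟨_, h⟩
    exact ⟨h, hx0⟩

lemma sum_sigmaPow_one_mul (b : ℕ) :
    ∑ p ∈ antidiagonal b, (sigmaPow 1 p.1 : ℤ) * sigmaPow 1 p.2
      = ∑ m₁ ∈ Icc 1 b, ∑ m₂ ∈ Icc 1 b, ∑ n₁ ∈ Icc 1 b, ∑ n₂ ∈ Icc 1 b,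
        if m₁ * n₁ + m₂ * n₂ = b then (m₁ : ℤ) * m₂ else 0 := by
  have h : ∀ p ∈ antidiagonal b, (sigmaPow 1 p.1 : ℤ) * sigmaPow 1 p.2
      = ∑ m₁ ∈ Icc 1 b, ∑ m₂ ∈ Icc 1 b, ∑ n₁ ∈ Icc 1 b, ∑ n₂ ∈ Icc 1 b,
        if (m₁ * n₁, m₂ * n₂) = p then (m₁ : ℤ) * m₂ else 0 := by
    intro p hp
    have hp := mem_antidiagonal.1 hp
    rw [sigmaPow_one_eq_sum (b := b) (by omega), sigmaPow_one_eq_sum (b := b) (by omega),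
      sum_mul_sum]
    refine sum_congr rfl fun m₁ _ => sum_congr rfl fun m₂ _ => ?_
    rw [sum_mul_sum]
    refine sum_congr rfl fun n₁ _ => sum_congr rfl fun n₂ _ => ?_
    rw [ite_zero_mul_ite_zero]
    simp only [Prod.ext_iff]
  rw [sum_congr rfl h, sum_comm]
  refine sum_congr rfl fun m₁ _ => ?_
  rw [sum_comm]
  refine sum_congr rfl fun m₂ _ => ?_
  rw [sum_comm]
  refine sum_congr rfl fun n₁ _ => ?_
  rw [sum_comm]
  refine sum_congr rfl fun n₂ _ => ?_
  rw [sum_ite_eq]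
  simp only [HasAntidiagonal.mem_antidiagonal]

lemma sigmaPow2_one_one_eq_sum (b : ℕ) :
    (sigmaPow2 1 1 b : ℤ) = ∑ m₁ ∈ Icc 1 b, ∑ m₂ ∈ Icc 1 b, ∑ n₁ ∈ Icc 1 b, ∑ n₂ ∈ Icc 1 b,
        if m₁ * n₁ + m₂ * n₂ = b ∧ n₁ < n₂ then (m₁ : ℤ) * m₂ else 0 := by
  rw [sigmaPow2, sum_filter, sum_product, sum_product]
  push_cast
  simp only [sum_product, pow_one]

lemma six_mul_sum_diagonal (b : ℕ) :
    6 * ∑ m₁ ∈ Icc 1 b, ∑ m₂ ∈ Icc 1 b, ∑ n ∈ Icc 1 b,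
        (if m₁ * n + m₂ * n = b then (m₁ : ℤ) * m₂ else 0)
      = (sigmaPow 3 b : ℤ) - sigmaPow 1 b := by
  have h1 : ∑ m₁ ∈ Icc 1 b, ∑ m₂ ∈ Icc 1 b, ∑ n ∈ Icc 1 b,
        (if m₁ * n + m₂ * n = b then (m₁ : ℤ) * m₂ else 0)
      = ∑ n ∈ Icc 1 b, ∑ m₁ ∈ Icc 1 b, ∑ m₂ ∈ Icc 1 b,
        (if m₁ * n + m₂ * n = b then (m₁ : ℤ) * m₂ else 0) := by
    rw [sum_comm (s := Icc 1 b) (t := Icc 1 b) (f := fun n m₁ => ∑ m₂ ∈ Icc 1 b,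
      if m₁ * n + m₂ * n = b then (m₁ : ℤ) * m₂ else 0)]
    exact sum_congr rfl fun m₁ _ => sum_comm
  have h2 : ∀ n ∈ Icc 1 b, 6 * ∑ m₁ ∈ Icc 1 b, ∑ m₂ ∈ Icc 1 b,
        (if m₁ * n + m₂ * n = b then (m₁ : ℤ) * m₂ else 0)
      = if n ∣ b then ((b / n : ℕ) : ℤ) ^ 3 - (b / n : ℕ) else 0 := by
    intro n hn
    obtain ⟨hn1, hn2⟩ := mem_Icc.1 hn
    split_ifs with hd
    · obtain ⟨e, rfl⟩ := hd
      rw [Nat.mul_div_cancel_left _ hn1, ← six_mul_sum_antidiagonal_mul]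
      congr 1
      rw [← sum_product', ← sum_filter]
      refine sum_subset ?_ ?_
      · intro p hp
        have hp := (mem_filter.1 hp).2
        rw [← add_mul, mul_comm] at hp
        exact mem_antidiagonal.2 (Nat.eq_of_mul_eq_mul_left hn1 hp)
      · intro p hp hp'
        have hp := mem_antidiagonal.1 hp
        by_cases h0 : p.1 = 0
        · simp [h0]
        by_cases h0' : p.2 = 0
        · simp [h0']
        refine absurd (mem_filter.2 ⟨?_, ?_⟩) hp'
        · have : e ≤ n * e := Nat.le_mul_of_pos_left _ hn1
          simp only [mem_product, mem_Icc]
          omega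
        · rw [← hp]
          ring
    · rw [sum_eq_zero, mul_zero]
      refine fun m₁ _ => sum_eq_zero fun m₂ _ => if_neg fun h => hd ⟨m₁ + m₂, ?_⟩
      rw [← h]
      ring
  rw [h1, mul_sum, sum_congr rfl h2, ← sum_filter]
  have h3 : (Icc 1 b).filter (· ∣ b) = b.divisors := by
    ext n
    simp only [mem_filter, mem_Icc, Nat.mem_divisors]
    constructor
    · rintro ⟨⟨h, h'⟩, h''⟩
      exact ⟨h'', by omega⟩
    · rintro ⟨h, h'⟩
      exact ⟨⟨Nat.pos_of_dvd_of_pos h (by omega), Nat.le_of_dvd (by omega) h⟩, h⟩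
  rw [h3, Nat.sum_div_divisors b fun e => (e : ℤ) ^ 3 - e, sum_sub_distrib, sigmaPow, sigmaPow]
  push_cast
  simp

/-- Convolution square of `σ₁` in terms of the depth-two multiple divisor sum. -/
lemma six_mul_sum_sigmaPow_one_mul (b : ℕ) :
    6 * ∑ p ∈ antidiagonal b, (sigmaPow 1 p.1 : ℤ) * sigmaPow 1 p.2
      = 12 * sigmaPow2 1 1 b + sigmaPow 3 b - sigmaPow 1 b := by
  have hsplit : ∑ p ∈ antidiagonal b, (sigmaPow 1 p.1 : ℤ) * sigmaPow 1 p.2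
      = ∑ m₁ ∈ Icc 1 b, ∑ m₂ ∈ Icc 1 b, ∑ n₁ ∈ Icc 1 b, ∑ n₂ ∈ Icc 1 b,
          (if m₁ * n₁ + m₂ * n₂ = b ∧ n₁ < n₂ then (m₁ : ℤ) * m₂ else 0)
        + ∑ m₁ ∈ Icc 1 b, ∑ m₂ ∈ Icc 1 b, ∑ n₁ ∈ Icc 1 b, ∑ n₂ ∈ Icc 1 b,
          (if m₁ * n₁ + m₂ * n₂ = b ∧ n₂ < n₁ then (m₁ : ℤ) * m₂ else 0)
        + ∑ m₁ ∈ Icc 1 b, ∑ m₂ ∈ Icc 1 b, ∑ n ∈ Icc 1 b,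
          (if m₁ * n + m₂ * n = b then (m₁ : ℤ) * m₂ else 0) := by
    rw [sum_sigmaPow_one_mul]
    simp only [← sum_add_distrib]
    refine sum_congr rfl fun m₁ _ => sum_congr rfl fun m₂ _ => sum_congr rfl fun n₁ h₁ => ?_
    have hd : (if m₁ * n₁ + m₂ * n₁ = b then (m₁ : ℤ) * m₂ else 0)
        = ∑ n₂ ∈ Icc 1 b, if n₁ = n₂ then
          (if m₁ * n₁ + m₂ * n₂ = b then (m₁ : ℤ) * m₂ else 0) else 0 := by
      rw [sum_ite_eq, if_pos h₁]
    rw [hd, ← sum_add_distrib]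
    refine sum_congr rfl fun n₂ _ => ?_
    rcases lt_trichotomy n₁ n₂ with h | h | h
    · simp [h, h.not_gt, h.ne]
    · simp [h]
    · simp [h, h.not_gt, h.ne']
  have hswap : ∑ m₁ ∈ Icc 1 b, ∑ m₂ ∈ Icc 1 b, ∑ n₁ ∈ Icc 1 b, ∑ n₂ ∈ Icc 1 b,
          (if m₁ * n₁ + m₂ * n₂ = b ∧ n₂ < n₁ then (m₁ : ℤ) * m₂ else 0)
      = sigmaPow2 1 1 b := by
    rw [sigmaPow2_one_one_eq_sum, sum_comm]
    refine sum_congr rfl fun m₁ _ => sum_congr rfl fun m₂ _ => ?_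
    rw [sum_comm]
    refine sum_congr rfl fun n₁ _ => sum_congr rfl fun n₂ _ => ?_
    rw [add_comm, mul_comm (m₁ : ℤ)]
  rw [hsplit, hswap, ← sigmaPow2_one_one_eq_sum]
  linear_combination six_mul_sum_diagonal b

end DivisorSums

section Derivations

variable {K R : Type*} [CommRing K] [CommRing R] [Algebra K R]

/-- The derivation of `R⟦X⟧` acting coefficientwise by a derivation of `R`. -/
noncomputable def coeffDerivation (d : Derivation K R R) : Derivation K R⟦X⟧ R⟦X⟧ :=
  Derivation.mk'
    { toFun F := PowerSeries.mk fun n => d (coeff n F)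
      map_add' F G := by ext; simp
      map_smul' a F := by ext; simp }
    (by
      intro F G
      ext n
      simp only [LinearMap.coe_mk, AddHom.coe_mk, coeff_mk, coeff_mul, smul_eq_mul, map_add,
        map_sum, Derivation.leibniz, sum_add_distrib]
      congr 1
      rw [← Nat.sum_antidiagonal_swap]
      simp only [Prod.fst_swap, Prod.snd_swap])

lemma coeff_coeffDerivation (d : Derivation K R R) (F : R⟦X⟧) (n : ℕ) :
    coeff n (coeffDerivation d F) = d (coeff n F) := by
  change coeff n (PowerSeries.mk fun n => d (coeff n F)) = _
  rw [coeff_mk]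

lemma coeff_iterate_coeffDerivation (d : Derivation K R R) (F : R⟦X⟧) (n j : ℕ) :
    coeff n ((coeffDerivation d)^[j] F) = d^[j] (coeff n F) := by
  induction j with
  | zero => rfl
  | succ j ih => rw [Function.iterate_succ_apply', Function.iterate_succ_apply',
      coeff_coeffDerivation, ih]

lemma iterate_derivation_eq {d : Derivation K R R} {w : R} {c : ℤ} (h : d w = c * w) (j : ℕ) :
    d^[j] w = c ^ j * w := by
  induction j with
  | zero => simp
  | succ j ih =>
    rw [Function.iterate_succ_apply', ih, ← Int.cast_pow, Derivation.leibniz, h,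
      Derivation.map_intCast]
    simp only [smul_eq_mul]
    push_cast
    ring

lemma derivation_pow_eq {d : Derivation K R R} {w : R} {c : ℤ} (h : d w = c * w) (m : ℕ) :
    d (w ^ m) = ((c * m : ℤ) : R) * w ^ m := by
  rcases m with _ | m
  · simp
  · rw [Derivation.leibniz_pow, h]
    simp only [smul_eq_mul, nsmul_eq_mul, Nat.add_sub_cancel]
    push_cast
    ring

lemma derivation_units_inv {d : Derivation K R R} {u : Rˣ} (h : d (u : R) = u) :
    d (↑u⁻¹ : R) = ((-1 : ℤ) : R) * (↑u⁻¹ : R) := by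
  have h1 := congrArg d u.inv_mul
  rw [Derivation.leibniz, h, Derivation.map_one_eq_zero] at h1
  simp only [smul_eq_mul, Units.inv_mul] at h1
  have h2 := u.inv_mul
  push_cast
  linear_combination (↑u⁻¹ : R) * h1 - d (↑u⁻¹ : R) * h2

lemma derivation_units_zpow {d : Derivation K R R} {u : Rˣ} (h : d (u : R) = u) (c : ℤ) :
    d ((u ^ c : Rˣ) : R) = c * ((u ^ c : Rˣ) : R) := by
  rcases c with m | m
  · have := derivation_pow_eq (d := d) (w := (u : R)) (c := 1) (by simpa using h) m
    simpa using this
  · have := derivation_pow_eq (derivation_units_inv h) (m + 1)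
    rw [Int.negSucc_eq, zpow_neg, ← inv_zpow]
    have e : (u⁻¹ : Rˣ) ^ ((m : ℤ) + 1) = u⁻¹ ^ (m + 1) := by
      rw [← zpow_natCast]
      push_cast
      rfl
    rw [e, Units.val_pow_eq_pow_val, this]
    push_cast
    ring

lemma derivation_geomSeries {d : Derivation K R R} {w : R} {c : ℤ} (h : d w = c * w) {i : ℕ}
    (hi : 1 ≤ i) : coeffDerivation d (geomSeries w i)
      = c * (geomSeries w i * (geomSeries w i - 1)) := by
  have hX : coeffDerivation d (X : R⟦X⟧) = 0 := by
    ext n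
    rw [coeff_coeffDerivation, coeff_X]
    split_ifs <;> simp
  have hC : coeffDerivation d (C w) = c * C w := by
    ext n
    have : (c : R⟦X⟧) = C (c : R) := by simp
    rw [coeff_coeffDerivation, this, ← map_mul, coeff_C, coeff_C]
    split_ifs <;> simp [h]
  have h1 := one_sub_mul_geomSeries w hi
  have h2 := congrArg (coeffDerivation d) h1
  rw [Derivation.leibniz, Derivation.map_sub, Derivation.map_one_eq_zero, Derivation.leibniz,
    Derivation.leibniz_pow, hX, hC] at h2
  simp only [smul_eq_mul, smul_zero, mul_zero, zero_add, zero_sub] at h2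
  linear_combination geomSeries w i * h2 - coeffDerivation d (geomSeries w i) * h1
    - (c : R⟦X⟧) * geomSeries w i * h1

lemma derivation_prod_eq {A ι : Type*} [CommRing A] [Algebra K A] {D : Derivation K A A}
    {f l : ι → A} {s : Finset ι} (h : ∀ i ∈ s, D (f i) = f i * l i) :
    D (∏ i ∈ s, f i) = (∏ i ∈ s, f i) * ∑ i ∈ s, l i := by
  classical
  induction s using Finset.induction_on with
  | empty => simp
  | insert a s ha ih =>
    rw [prod_insert ha, sum_insert ha, Derivation.leibniz, h a (mem_insert_self a s),
      ih fun i hi => h i (mem_insert_of_mem hi)]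
    simp only [smul_eq_mul]
    ring

lemma iterate_four_derivation {A : Type*} [CommRing A] [Algebra K A] {D : Derivation K A A}
    {F L : A} (h : D F = F * L) :
    D^[4] F = F * (L ^ 4 + 6 * L ^ 2 * D L + 3 * D L ^ 2 + 4 * L * D (D L)
      + D (D (D L))) := by
  have h4 : D (4 : A) = 0 := Derivation.map_natCast D 4
  have h3 : D (3 : A) = 0 := Derivation.map_natCast D 3
  simp only [Function.iterate_succ, Function.iterate_zero, Function.comp_apply, id, h,
    Derivation.leibniz, map_add, smul_eq_mul]
  ring

/-- The logarithmic derivative of `crankSeries`. -/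
noncomputable def crankLogDeriv (N : ℕ) (u : Rˣ) : R⟦X⟧ :=
  ∑ i ∈ Icc 1 N, (geomSeries (u : R) i - geomSeries (↑u⁻¹ : R) i)

lemma derivation_crankSeries {d : Derivation K R R} {u : Rˣ} (h : d (u : R) = u) (N : ℕ) :
    coeffDerivation d (crankSeries N u) = crankSeries N u * crankLogDeriv N u := by
  refine derivation_prod_eq fun i hi => ?_
  have hi := (mem_Icc.1 hi).1
  have hX : coeffDerivation d (1 - X ^ i : R⟦X⟧) = 0 := by
    ext n
    rw [coeff_coeffDerivation, map_sub, coeff_one, coeff_X_pow]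
    split_ifs <;> simp
  rw [Derivation.leibniz, Derivation.leibniz, hX,
    derivation_geomSeries (w := (u : R)) (c := 1) (by simpa using h) hi,
    derivation_geomSeries (derivation_units_inv h) hi]
  simp only [smul_eq_mul]
  push_cast
  ring

lemma map_iterate_derivation_geomSeries {d : Derivation K R R} {w : R} {c : ℤ} (h : d w = c * w)
    {S : Type*} [CommRing S] (φ : R →+* S) (hφ : φ w = 1) (i j : ℕ) :
    PowerSeries.map φ ((coeffDerivation d)^[j] (geomSeries w i))
      = (c : S⟦X⟧) ^ j * PowerSeries.mk fun n => if i ∣ n then ((n / i : ℕ) : S) ^ j else 0 := by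
  ext n
  have hc : (c : S⟦X⟧) ^ j = C ((c : S) ^ j) := by simp
  rw [coeff_map, coeff_iterate_coeffDerivation, hc, coeff_C_mul, geomSeries, coeff_mk, coeff_mk]
  split_ifs
  · rw [iterate_derivation_eq (derivation_pow_eq h _)]
    generalize n / i = q
    simp [hφ, mul_pow]
  · rw [iterate_map_zero]
    simp

/-- The truncated generating function of `∑_{d ∣ n} dʲ`. -/
noncomputable def sigmaSeries (S : Type*) [CommRing S] (N j : ℕ) : S⟦X⟧ :=
  ∑ i ∈ Icc 1 N, PowerSeries.mk fun n => if i ∣ n then ((n / i : ℕ) : S) ^ j else 0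

lemma coeff_sigmaSeries (S : Type*) [CommRing S] {N j m : ℕ} (hj : j ≠ 0) (hm : m ≤ N) :
    coeff m (sigmaSeries S N j) = sigmaPow j m := by
  rw [sigmaSeries, map_sum]
  simp only [coeff_mk]
  by_cases h0 : m = 0
  · simp [h0, sigmaPow, hj]
  · rw [← sum_filter]
    have h3 : (Icc 1 N).filter (· ∣ m) = m.divisors := by
      ext n
      simp only [mem_filter, mem_Icc, Nat.mem_divisors]
      constructor
      · rintro ⟨_, h⟩
        exact ⟨h, h0⟩
      · rintro ⟨h, _⟩
        exact ⟨⟨Nat.pos_of_dvd_of_pos h (by omega),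
          (Nat.le_of_dvd (by omega) h).trans hm⟩, h⟩
    rw [h3, Nat.sum_div_divisors m fun e => (e : S) ^ j, sigmaPow]
    push_cast
    rfl

lemma map_iterate_derivation_crankLogDeriv {d : Derivation K R R} {u : Rˣ} (h : d (u : R) = u)
    {S : Type*} [CommRing S] (φ : R →+* S) (hφ : φ u = 1) (N j : ℕ) :
    PowerSeries.map φ ((coeffDerivation d)^[j] (crankLogDeriv N u))
      = (1 - (-1) ^ j) * sigmaSeries S N j := by
  have hφ' : φ (↑u⁻¹ : R) = 1 := by
    have := congrArg φ u.inv_mul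
    rwa [map_mul, hφ, mul_one, map_one] at this
  have hit : ∀ F : R⟦X⟧, (coeffDerivation d)^[j] F
      = ((coeffDerivation d : R⟦X⟧ →ₗ[K] R⟦X⟧) ^ j) F := fun F => by
    rw [Module.End.pow_apply]
    rfl
  rw [hit, crankLogDeriv, map_sum, map_sum, sigmaSeries, mul_sum]
  refine sum_congr rfl fun i _ => ?_
  rw [map_sub, ← hit, ← hit, map_sub,
    map_iterate_derivation_geomSeries (w := (u : R)) (c := 1) (by simpa using h) φ hφ,
    map_iterate_derivation_geomSeries (derivation_units_inv h) φ hφ']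
  push_cast
  ring

lemma map_crankSeries {u : Rˣ} {S : Type*} [CommRing S] (φ : R →+* S) (hφ : φ u = 1) (N : ℕ) :
    PowerSeries.map φ (crankSeries N u) = ∏ i ∈ Icc 1 N, geomSeries (1 : S) i := by
  have hφ' : φ (↑u⁻¹ : R) = 1 := by
    have := congrArg φ u.inv_mul
    rwa [map_mul, hφ, mul_one, map_one] at this
  have hg : ∀ w : R, φ w = 1 → ∀ i, PowerSeries.map φ (geomSeries w i) = geomSeries 1 i := by
    intro w hw i
    ext n
    simp only [geomSeries, coeff_map, coeff_mk]
    split_ifs <;> simp [hw]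
  rw [crankSeries, map_prod]
  refine prod_congr rfl fun i hi => ?_
  have := one_sub_mul_geomSeries (1 : S) (mem_Icc.1 hi).1
  rw [map_one, one_mul] at this
  rw [map_mul, map_mul, hg _ hφ, hg _ hφ', map_sub, map_one, map_pow, map_X, this, one_mul]

lemma sum_crank_pow_four {d : Derivation K R R} {u : Rˣ} (h : d (u : R) = u)
    {S : Type*} [CommRing S] (φ : R →+* S) (hφ : φ u = 1) {N : ℕ} (hN : 2 ≤ N) :
    ∑ lam : N.Partition, (crank lam : S) ^ 4
      = coeff N ((∏ i ∈ Icc 1 N, geomSeries (1 : S) i) *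
        (12 * sigmaSeries S N 1 ^ 2 + 2 * sigmaSeries S N 3)) := by
  have hL := map_iterate_derivation_crankLogDeriv h φ hφ N
  have hL0 := hL 0
  have hL1 := hL 1
  have hL2 := hL 2
  have hL3 := hL 3
  simp only [Function.iterate_succ, Function.iterate_zero, Function.comp_apply, id]
    at hL0 hL1 hL2 hL3
  have key := congrArg (PowerSeries.map φ) (iterate_four_derivation (derivation_crankSeries h N))
  simp only [map_mul, map_add, map_pow, hL0, hL1, hL2, hL3, map_crankSeries φ hφ, map_ofNat] at key
  have e : (∏ i ∈ Icc 1 N, geomSeries (1 : S) i) *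
        (12 * sigmaSeries S N 1 ^ 2 + 2 * sigmaSeries S N 3)
      = PowerSeries.map φ ((coeffDerivation d)^[4] (crankSeries N u)) := by
    rw [key]
    ring
  have hφz : ∀ c : ℤ, φ ((u ^ c : Rˣ) : R) = 1 := by
    intro c
    have : Units.map (φ : R →* S) u = 1 := Units.ext hφ
    have := congrArg (fun v : Sˣ => ((v ^ c : Sˣ) : S)) this
    simp only [← map_zpow, one_zpow, Units.val_one] at this
    exact this
  rw [e, coeff_map, coeff_iterate_coeffDerivation, coeff_crankSeries hN]
  have hit : ∀ F : R, d^[4] F = ((d : R →ₗ[K] R) ^ 4) F := fun F => by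
    rw [Module.End.pow_apply]
    rfl
  rw [hit, map_sum, map_sum]
  refine sum_congr rfl fun lam _ => ?_
  rw [← hit, iterate_derivation_eq (derivation_units_zpow h _), map_mul, hφz, mul_one, map_pow,
    map_intCast]

end Derivations

theorem fourth_crank_moment (n : ℕ) (hn : 2 ≤ n) :
    ∑ lam : Nat.Partition n, crank lam ^ 4
      = 2 * ∑ a ∈ Finset.range n, (partitionCount a : ℤ)
          * (12 * (sigmaPow2 1 1 (n - a) : ℤ) + 2 * (sigmaPow 3 (n - a) : ℤ)
            - (sigmaPow 1 (n - a) : ℤ)) := by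
  let u : ℚ⟦X⟧ˣ := Units.mkOfMulEqOne _ _ (PowerSeries.exp_mul_exp_neg_eq_one (A := ℚ))
  have hu : derivative ℚ (u : ℚ⟦X⟧) = u := derivative_exp ℚ
  have hc : constantCoeff (u : ℚ⟦X⟧) = 1 := constantCoeff_exp
  have h := sum_crank_pow_four hu constantCoeff hc hn
  have hcoeff : ∀ b, b ≤ n → coeff b (12 * sigmaSeries ℚ n 1 ^ 2 + 2 * sigmaSeries ℚ n 3)
      = ((2 * (12 * (sigmaPow2 1 1 b : ℤ) + 2 * (sigmaPow 3 b : ℤ) - (sigmaPow 1 b : ℤ)) : ℤ)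
        : ℚ) := by
    intro b hb
    have e : (12 * sigmaSeries ℚ n 1 ^ 2 + 2 * sigmaSeries ℚ n 3 : ℚ⟦X⟧)
        = C 12 * (sigmaSeries ℚ n 1 * sigmaSeries ℚ n 1) + C 2 * sigmaSeries ℚ n 3 := by
      simp only [map_ofNat]
      ring
    have e2 : ∑ p ∈ antidiagonal b, coeff p.1 (sigmaSeries ℚ n 1) * coeff p.2 (sigmaSeries ℚ n 1)
        = ∑ p ∈ antidiagonal b, (sigmaPow 1 p.1 : ℚ) * sigmaPow 1 p.2 := by
      refine sum_congr rfl fun p hp => ?_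
      have := mem_antidiagonal.1 hp
      rw [coeff_sigmaSeries ℚ one_ne_zero (by omega), coeff_sigmaSeries ℚ one_ne_zero (by omega)]
    have h6 := congrArg (Int.cast : ℤ → ℚ) (six_mul_sum_sigmaPow_one_mul b)
    push_cast at h6
    rw [e, map_add, coeff_C_mul, coeff_C_mul, coeff_mul, e2,
      coeff_sigmaSeries ℚ three_ne_zero hb]
    push_cast
    linear_combination 2 * h6
  rw [coeff_mul, Nat.sum_antidiagonal_eq_sum_range_succ_mk, sum_range_succ] at h
  rw [hcoeff _ (Nat.sub_le n n), Nat.sub_self] at h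
  have h0 : sigmaPow2 1 1 0 = 0 ∧ sigmaPow 3 0 = 0 ∧ sigmaPow 1 0 = 0 := by
    simp [sigmaPow2, sigmaPow]
  have hsum : ∑ k ∈ range n, coeff k (∏ i ∈ Icc 1 n, geomSeries (1 : ℚ) i) *
        coeff (n - k) (12 * sigmaSeries ℚ n 1 ^ 2 + 2 * sigmaSeries ℚ n 3)
      = ((2 * ∑ a ∈ range n, (partitionCount a : ℤ)
          * (12 * (sigmaPow2 1 1 (n - a) : ℤ) + 2 * (sigmaPow 3 (n - a) : ℤ)
            - (sigmaPow 1 (n - a) : ℤ)) : ℤ) : ℚ) := by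
    rw [mul_sum, Int.cast_sum]
    refine sum_congr rfl fun k hk => ?_
    rw [hcoeff _ (Nat.sub_le n k), coeff_prod_geomSeries_one (mem_range.1 hk).le]
    push_cast
    ring
  rw [hsum, h0.1, h0.2.1, h0.2.2] at h
  simp only [Nat.cast_zero, mul_zero, add_zero, sub_zero, Int.cast_zero] at h
  exact_mod_cast h
end
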